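/- arXiv:quant-ph/0412001 — 2 statements merged into one kernel-verified Lean document; each statement's English description precedes it below -/
import Mathlib

section
/- Let d ≥ 2. For every 2×2 integer matrix F with det F ≡ −1 (mod d̄) and every χ ∈ ℤ², there exists a d×d unitary matrix A such that A · conj(D_p) · A† = ω^{⟨χ, Fp⟩} D_{Fp} for all p ∈ ℤ², where conj(M) denotes the entrywise complex conjugate of the matrix M. (Equivalently, the anti-unitary map ψ ↦ A·conj(ψ) conjugates each D_p to ω^{⟨χ, Fp⟩} D_{Fp}, so every element of ESL(2, ℤ/d̄ℤ) of determinant −1, together with any χ, is realized by an anti-unitary element of the extended Clifford group.) -/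
noncomputable section
open Matrix Complex

/-- `d̄ = d` for odd `d`, `2d` for even `d`. -/
def dbar (d : ℕ) : ℕ := if d % 2 = 1 then d else 2 * d

/-- `ω = exp(2πi/d)`. -/
def omega (d : ℕ) : ℂ := Complex.exp (2 * Real.pi * Complex.I / d)

/-- `τ = −exp(πi/d)`. -/
def tau (d : ℕ) : ℂ := -Complex.exp (Real.pi * Complex.I / d)

/-- The diagonal matrix `T e_r = ω^r e_r`. -/
def Tmat (d : ℕ) : Matrix (Fin d) (Fin d) ℂ :=
  Matrix.diagonal fun r => omega d ^ (r : ℕ)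

/-- The cyclic shift `S e_r = e_{r+1 mod d}`. -/
def Smat (d : ℕ) : Matrix (Fin d) (Fin d) ℂ :=
  Matrix.of fun r s => if (r : ℕ) = ((s : ℕ) + 1) % d then 1 else 0

/-- The displacement operators `D_p = τ^{p₁p₂} S^{p₁} T^{p₂}`. -/
def Dmat (d : ℕ) (p : ℤ × ℤ) : Matrix (Fin d) (Fin d) ℂ :=
  tau d ^ (p.1 * p.2) • (Smat d ^ p.1 * Tmat d ^ p.2)

/-- The symplectic form `⟨p,q⟩ = p₂q₁ − p₁q₂`. -/
def symp (p q : ℤ × ℤ) : ℤ := p.2 * q.1 - p.1 * q.2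

/-- Action of a 2×2 integer matrix on `ℤ²`. -/
def Fapp (F : Matrix (Fin 2) (Fin 2) ℤ) (p : ℤ × ℤ) : ℤ × ℤ :=
  (F 0 0 * p.1 + F 0 1 * p.2, F 1 0 * p.1 + F 1 1 * p.2)

/-- The generalized Pauli group `W(d) = {e^{iξ} D_p}`, as a set of matrices. -/
def Wset (d : ℕ) : Set (Matrix (Fin d) (Fin d) ℂ) :=
  {M | ∃ ξ : ℝ, ∃ p : ℤ × ℤ, M = Complex.exp (ξ * Complex.I) • Dmat d p}

lemma isPrimitiveRoot_omega {d : ℕ} (hd : d ≠ 0) : IsPrimitiveRoot (omega d) d :=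
  Complex.isPrimitiveRoot_exp d hd

lemma omega_ne_zero (d : ℕ) : omega d ≠ 0 := Complex.exp_ne_zero _

lemma tau_ne_zero (d : ℕ) : tau d ≠ 0 := neg_ne_zero.mpr (Complex.exp_ne_zero _)

lemma tau_sq (d : ℕ) : tau d ^ 2 = omega d := by
  rw [tau, omega, neg_sq, ← Complex.exp_nat_mul]
  congr 1
  push_cast
  ring

lemma tau_pow_self {d : ℕ} (hd : d ≠ 0) : tau d ^ d = (-1) ^ (d + 1) := by
  have hd' : (d : ℂ) ≠ 0 := by exact_mod_cast hd
  rw [tau, neg_pow, ← Complex.exp_nat_mul, mul_div_cancel₀ _ hd', Complex.exp_pi_mul_I, pow_succ]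

lemma tau_pow_dbar {d : ℕ} (hd : d ≠ 0) : tau d ^ dbar d = 1 := by
  unfold dbar
  split_ifs with h
  · rw [tau_pow_self hd]
    exact (Nat.even_add_one.mpr (Nat.not_even_iff.mpr h)).neg_one_pow
  · rw [mul_comm, pow_mul, tau_pow_self hd, ← pow_mul, mul_comm]
    simp [pow_mul]

lemma tau_pow_mul_self {d : ℕ} (hd : d ≠ 0) : tau d ^ (d * d) = 1 := by
  rw [pow_mul, tau_pow_self hd, ← pow_mul, mul_comm]
  exact (Nat.even_mul_succ_self d).neg_one_pow

lemma tau_zpow_eq {d : ℕ} (hd : d ≠ 0) {a b : ℤ} (h : a ≡ b [ZMOD (dbar d)]) :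
    tau d ^ a = tau d ^ b := by
  obtain ⟨k, hk⟩ := h.dvd
  rw [show b = a + dbar d * k by omega, zpow_add₀ (tau_ne_zero d), _root_.zpow_mul, zpow_natCast,
    tau_pow_dbar hd, _root_.one_zpow, mul_one]

lemma omega_zpow (d : ℕ) (a : ℤ) : omega d ^ a = tau d ^ (2 * a) := by
  rw [_root_.zpow_mul, ← tau_sq]
  norm_cast

lemma conj_tau (d : ℕ) : starRingEnd ℂ (tau d) = (tau d)⁻¹ := by
  rw [tau, map_neg, ← Complex.exp_conj, inv_neg, ← Complex.exp_neg]
  congr 2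
  simp [neg_div]

lemma conj_omega (d : ℕ) : starRingEnd ℂ (omega d) = (omega d)⁻¹ := by
  rw [← tau_sq, map_pow, conj_tau, inv_pow]

section MatrixGeneral

variable {n : Type*} [Fintype n] [DecidableEq n]

lemma Matrix.smul_zpow_of_ne_zero {c : ℂ} (hc : c ≠ 0) {X : Matrix n n ℂ} (hX : IsUnit X.det)
    (k : ℤ) : (c • X) ^ k = c ^ k • X ^ k := by
  cases k with
  | ofNat m => simp [smul_pow]
  | negSucc m =>
    rw [zpow_negSucc, zpow_negSucc, zpow_negSucc, smul_pow]
    have h : IsUnit (X ^ (m + 1)).det := by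
      rw [Matrix.det_pow]; exact hX.pow _
    apply Matrix.inv_eq_right_inv
    rw [smul_mul_smul_comm, Matrix.mul_nonsing_inv _ h, mul_inv_cancel₀ (pow_ne_zero _ hc),
      one_smul]

lemma Matrix.mul_zpow_of_mul_eq_smul {c : ℂ} (hc : c ≠ 0) {X Z : Matrix n n ℂ}
    (hX : IsUnit X.det) (h : Z * X = c • (X * Z)) (k : ℤ) :
    Z * X ^ k = c ^ k • (X ^ k * Z) := by
  have h1 : SemiconjBy Z X (c • X) := by
    rw [SemiconjBy, h, smul_mul_assoc]
  have hcX : IsUnit (c • X).det := by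
    rw [Matrix.det_smul]
    exact ((isUnit_iff_ne_zero.mpr hc).pow _).mul hX
  have h2 := Matrix.SemiconjBy.zpow_right hX hcX h1 k
  rw [SemiconjBy, Matrix.smul_zpow_of_ne_zero hc hX] at h2
  rw [h2, smul_mul_assoc]

lemma Matrix.zpow_mul_zpow_of_mul_eq_smul {c : ℂ} (hc : c ≠ 0) {X Z : Matrix n n ℂ}
    (hX : IsUnit X.det) (hZ : IsUnit Z.det) (h : Z * X = c • (X * Z)) (a b : ℤ) :
    Z ^ b * X ^ a = c ^ (a * b) • (X ^ a * Z ^ b) := by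
  have h1 := Matrix.mul_zpow_of_mul_eq_smul hc hX h a
  have hca : c ^ a ≠ 0 := zpow_ne_zero _ hc
  have h2 : X ^ a * Z = (c ^ a)⁻¹ • (Z * X ^ a) := by
    rw [h1, inv_smul_smul₀ hca]
  rw [Matrix.mul_zpow_of_mul_eq_smul (inv_ne_zero hca) hZ h2 b, smul_smul, _root_.zpow_mul, _root_.inv_zpow,
    mul_inv_cancel₀ (zpow_ne_zero _ hca), one_smul]

lemma Matrix.isUnit_det_of_mem_unitaryGroup {U : Matrix n n ℂ}
    (hU : U ∈ Matrix.unitaryGroup n ℂ) : IsUnit U.det :=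
  (Matrix.isUnit_iff_isUnit_det U).mp (Unitary.isUnit_coe (U := ⟨U, hU⟩))

lemma Matrix.zpow_mem_unitaryGroup {U : Matrix n n ℂ} (hU : U ∈ Matrix.unitaryGroup n ℂ)
    (k : ℤ) : U ^ k ∈ Matrix.unitaryGroup n ℂ := by
  cases k with
  | ofNat m => simpa using pow_mem hU m
  | negSucc m =>
    have h := pow_mem hU (m + 1)
    rw [zpow_negSucc, Matrix.inv_eq_right_inv (Matrix.mem_unitaryGroup_iff.mp h)]
    exact Unitary.star_mem h

lemma Matrix.zpow_semiconj_conj {A X Y : Matrix n n ℂ} (hA : A ∈ Matrix.unitaryGroup n ℂ)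
    (hX : IsUnit X.det) (hY : IsUnit Y.det) (h : A * X = Y * A) (k : ℤ) :
    A * X ^ k * Aᴴ = Y ^ k := by
  have h' : SemiconjBy A (X ^ k) (Y ^ k) := Matrix.SemiconjBy.zpow_right hX hY h k
  rw [h'.eq, mul_assoc, ← Matrix.star_eq_conjTranspose, Matrix.mem_unitaryGroup_iff.mp hA, mul_one]

/-- A unitary `Z` with `Z ^ d = 1` that commutes up to the root of unity `ω` with an invertible `X`
fixes some unit vector. -/
lemma exists_unit_fixed_vector [Nonempty n] {d : ℕ} (hd : d ≠ 0) {X Z : Matrix n n ℂ}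
    (hX : IsUnit X.det) (hZd : Z ^ d = 1) (h : Z * X = omega d • (X * Z)) :
    ∃ v : n → ℂ, star v ⬝ᵥ v = 1 ∧ Z *ᵥ v = v := by
  obtain ⟨μ, hμ⟩ := Module.End.exists_eigenvalue (Matrix.toLin' Z)
  obtain ⟨w, hw⟩ := hμ.exists_hasEigenvector
  have hw0 : w ≠ 0 := hw.2
  have hZw : Z *ᵥ w = μ • w := by simpa using hw.apply_eq_smul
  have hpow : ∀ k : ℕ, (Z ^ k) *ᵥ w = μ ^ k • w := by
    intro k
    induction k with
    | zero => simp
    | succ k ih =>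
      rw [pow_succ, ← Matrix.mulVec_mulVec, hZw, Matrix.mulVec_smul, ih, smul_smul, pow_succ']
  have hμd : μ ^ d = 1 := by
    have := hpow d
    rw [hZd, Matrix.one_mulVec] at this
    have h2 : (μ ^ d - 1) • w = 0 := by rw [sub_smul, ← this, one_smul, sub_self]
    exact sub_eq_zero.mp ((smul_eq_zero.mp h2).resolve_right hw0)
  have : NeZero d := ⟨hd⟩
  obtain ⟨k, hk, hkμ⟩ := (isPrimitiveRoot_omega hd).eq_pow_of_pow_eq_one hμd
  have hXm := Matrix.mul_zpow_of_mul_eq_smul (omega_ne_zero d) hX h (-k)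
  set u := (X ^ (-k : ℤ)) *ᵥ w with hu
  have hZu : Z *ᵥ u = u := by
    rw [hu, Matrix.mulVec_mulVec, hXm, Matrix.smul_mulVec, ← Matrix.mulVec_mulVec, hZw,
      Matrix.mulVec_smul, smul_smul, ← hkμ, ← zpow_natCast, ← zpow_add₀ (omega_ne_zero d)]
    simp
  have hu0 : u ≠ 0 := by
    intro h0
    apply hw0
    have h3 : (X ^ (k : ℤ)) *ᵥ u = w := by
      rw [hu, Matrix.mulVec_mulVec, ← Matrix.zpow_add hX]
      simp
    rw [← h3, h0, Matrix.mulVec_zero]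
  have hpos : 0 < ∑ i, ‖u i‖ ^ 2 := by
    obtain ⟨i, hi⟩ := Function.ne_iff.mp hu0
    exact Finset.sum_pos' (fun _ _ => by positivity)
      ⟨i, Finset.mem_univ i, pow_pos (norm_pos_iff.mpr hi) 2⟩
  have hN : star u ⬝ᵥ u = ((∑ i, ‖u i‖ ^ 2 : ℝ) : ℂ) := by
    simp [dotProduct, Complex.conj_mul']
  set N := ∑ i, ‖u i‖ ^ 2
  refine ⟨(((√N)⁻¹ : ℝ) : ℂ) • u, ?_, by rw [Matrix.mulVec_smul, hZu]⟩
  rw [star_smul, smul_dotProduct, dotProduct_smul, hN, smul_eq_mul, smul_eq_mul]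
  simp only [Complex.star_def, Complex.conj_ofReal]
  norm_cast
  have := Real.sq_sqrt hpos.le
  have h4 : √N ≠ 0 := (Real.sqrt_pos.mpr hpos).ne'
  field_simp
  linarith

end MatrixGeneral

lemma Smat_pow {d : ℕ} (hd : d ≠ 0) (k : ℕ) :
    Smat d ^ k = Matrix.of fun r s : Fin d => if (r : ℕ) = ((s : ℕ) + k) % d then 1 else 0 := by
  induction k with
  | zero =>
    ext r s
    simp [Matrix.one_apply, Fin.ext_iff, Nat.mod_eq_of_lt s.isLt]
  | succ k ih =>
    ext r s
    rw [pow_succ, ih, Matrix.mul_apply,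
      Finset.sum_eq_single (⟨(s + 1) % d, Nat.mod_lt _ (by omega)⟩ : Fin d)]
    · simp [Smat, add_assoc, add_comm 1 k]
    · intro b _ hb
      have : (b : ℕ) ≠ (s + 1) % d := fun h => hb (Fin.ext h)
      simp [Smat, this]
    · simp

lemma Smat_pow_self {d : ℕ} (hd : d ≠ 0) : Smat d ^ d = 1 := by
  rw [Smat_pow hd, ← pow_zero (Smat d), Smat_pow hd]
  simp

lemma Tmat_pow_self {d : ℕ} (hd : d ≠ 0) : Tmat d ^ d = 1 := by
  rw [Tmat, Matrix.diagonal_pow, ← Matrix.diagonal_one]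
  congr 1
  ext r
  rw [Pi.pow_apply, ← pow_mul, mul_comm, pow_mul, (isPrimitiveRoot_omega hd).pow_eq_one, one_pow]

/-- Right multiplication by the shift permutes columns. -/
lemma mul_Smat_apply {d : ℕ} (hd : d ≠ 0) (M : Matrix (Fin d) (Fin d) ℂ) (r s : Fin d) :
    (M * Smat d) r s = M r ⟨(s + 1) % d, Nat.mod_lt _ (by omega)⟩ := by
  rw [Matrix.mul_apply, Finset.sum_eq_single (⟨(s + 1) % d, Nat.mod_lt _ (by omega)⟩ : Fin d)]
  · simp [Smat]
  · intro b _ hb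
    have : (b : ℕ) ≠ (s + 1) % d := fun h => hb (Fin.ext h)
    simp [Smat, this]
  · simp

lemma Smat_mem_unitaryGroup {d : ℕ} (hd : d ≠ 0) : Smat d ∈ Matrix.unitaryGroup (Fin d) ℂ := by
  rw [Matrix.mem_unitaryGroup_iff']
  ext r s
  rw [mul_Smat_apply hd, Matrix.star_apply, Matrix.one_apply]
  have key : (s + 1) % d = (r + 1) % d ↔ r = s := by
    constructor
    · intro h
      have h1 : (s : ℕ) ≡ r [MOD d] := Nat.ModEq.add_right_cancel' 1 h
      exact Fin.ext (h1.symm.eq_of_lt_of_lt r.isLt s.isLt)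
    · rintro rfl; rfl
  by_cases h : r = s <;> simp [Smat, key, h]

lemma Tmat_mem_unitaryGroup (d : ℕ) : Tmat d ∈ Matrix.unitaryGroup (Fin d) ℂ := by
  rw [Matrix.mem_unitaryGroup_iff, Matrix.star_eq_conjTranspose, Tmat,
    Matrix.diagonal_conjTranspose, Matrix.diagonal_mul_diagonal, ← Matrix.diagonal_one]
  congr 1
  ext r
  simp [conj_omega, omega_ne_zero]

lemma Tmat_mul_Smat {d : ℕ} (hd : d ≠ 0) :
    Tmat d * Smat d = omega d • (Smat d * Tmat d) := by
  ext r s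
  rw [Tmat, Matrix.diagonal_mul, Matrix.smul_apply, Matrix.mul_diagonal]
  simp only [Smat, Matrix.of_apply, smul_eq_mul]
  split_ifs with h
  · rw [h, ← pow_eq_pow_mod _ (isPrimitiveRoot_omega hd).pow_eq_one]
    ring
  · simp

section WeylRelations

variable {d : ℕ}

lemma isUnit_det_Smat (hd : d ≠ 0) : IsUnit (Smat d).det :=
  Matrix.isUnit_det_of_mem_unitaryGroup (Smat_mem_unitaryGroup hd)

lemma isUnit_det_Tmat (d : ℕ) : IsUnit (Tmat d).det :=
  Matrix.isUnit_det_of_mem_unitaryGroup (Tmat_mem_unitaryGroup d)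

lemma Dmat_mul (hd : d ≠ 0) (p q : ℤ × ℤ) :
    Dmat d p * Dmat d q = tau d ^ symp p q • Dmat d (p + q) := by
  have h := Matrix.zpow_mul_zpow_of_mul_eq_smul (omega_ne_zero d) (isUnit_det_Smat hd)
    (isUnit_det_Tmat d) (Tmat_mul_Smat hd) q.1 p.2
  have h' : Smat d ^ p.1 * Tmat d ^ p.2 * (Smat d ^ q.1 * Tmat d ^ q.2) =
      omega d ^ (q.1 * p.2) • (Smat d ^ (p.1 + q.1) * Tmat d ^ (p.2 + q.2)) := by
    rw [Matrix.zpow_add (isUnit_det_Smat hd), Matrix.zpow_add (isUnit_det_Tmat d), mul_assoc,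
      ← mul_assoc (Tmat d ^ p.2), h]
    simp only [smul_mul_assoc, mul_smul_comm, mul_assoc]
  simp only [Dmat, smul_mul_assoc, mul_smul_comm, smul_smul, h', Prod.fst_add, Prod.snd_add,
    omega_zpow, ← zpow_add₀ (tau_ne_zero d), symp]
  congr 2
  ring

lemma Dmat_zero (d : ℕ) : Dmat d 0 = 1 := by simp [Dmat]

lemma Dmat_mem_unitaryGroup (hd : d ≠ 0) (p : ℤ × ℤ) :
    Dmat d p ∈ Matrix.unitaryGroup (Fin d) ℂ := by
  have h1 := mul_mem (Matrix.zpow_mem_unitaryGroup (Smat_mem_unitaryGroup hd) p.1)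
    (Matrix.zpow_mem_unitaryGroup (Tmat_mem_unitaryGroup d) p.2)
  rw [Matrix.mem_unitaryGroup_iff] at h1 ⊢
  rw [Dmat, star_smul, smul_mul_smul_comm, h1]
  simp [conj_tau, zpow_ne_zero _ (tau_ne_zero d)]

lemma isUnit_det_Dmat (hd : d ≠ 0) (p : ℤ × ℤ) : IsUnit (Dmat d p).det :=
  Matrix.isUnit_det_of_mem_unitaryGroup (Dmat_mem_unitaryGroup hd p)

lemma Dmat_pow (hd : d ≠ 0) (p : ℤ × ℤ) (k : ℕ) : Dmat d p ^ k = Dmat d ((k : ℤ) • p) := by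
  induction k with
  | zero => simp [Dmat_zero]
  | succ k ih =>
    rw [pow_succ, ih, Dmat_mul hd, show symp ((k : ℤ) • p) p = 0 by simp [symp]; ring]
    simp [add_smul]

lemma Dmat_zpow (hd : d ≠ 0) (p : ℤ × ℤ) (k : ℤ) : Dmat d p ^ k = Dmat d (k • p) := by
  cases k with
  | ofNat m => simpa using Dmat_pow hd p m
  | negSucc m =>
    rw [zpow_negSucc, Dmat_pow hd]
    apply Matrix.inv_eq_right_inv
    rw [Dmat_mul hd, ← add_smul, Int.negSucc_eq]
    have : symp (((m + 1 : ℕ) : ℤ) • p) ((-((m : ℤ) + 1)) • p) = 0 := by simp [symp]; ring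
    rw [this]
    simp [Dmat_zero]

lemma Dmat_pow_self (hd : d ≠ 0) (p : ℤ × ℤ) : Dmat d p ^ d = 1 := by
  rw [Dmat_pow hd, Dmat]
  simp only [Prod.smul_fst, Prod.smul_snd, smul_eq_mul]
  rw [Matrix.zpow_mul _ (isUnit_det_Smat hd), Matrix.zpow_mul _ (isUnit_det_Tmat d), zpow_natCast,
    zpow_natCast, Smat_pow_self hd, Tmat_pow_self hd, Matrix.one_zpow, Matrix.one_zpow,
    show (d : ℤ) * p.1 * (d * p.2) = ((d * d : ℕ) : ℤ) * (p.1 * p.2) by push_cast; ring,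
    _root_.zpow_mul, zpow_natCast, tau_pow_mul_self hd]
  simp

lemma Dmat_mul_comm (hd : d ≠ 0) (p q : ℤ × ℤ) :
    Dmat d p * Dmat d q = omega d ^ symp p q • (Dmat d q * Dmat d p) := by
  rw [Dmat_mul hd, Dmat_mul hd, smul_smul, omega_zpow, ← zpow_add₀ (tau_ne_zero d), add_comm q p]
  congr 2
  simp only [symp]
  ring

lemma Dmat_conj (hd : d ≠ 0) (p q : ℤ × ℤ) :
    Dmat d p * Dmat d q * (Dmat d p)ᴴ = omega d ^ symp p q • Dmat d q := by
  rw [Dmat_mul_comm hd, smul_mul_assoc, mul_assoc, ← Matrix.star_eq_conjTranspose,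
    Matrix.mem_unitaryGroup_iff.mp (Dmat_mem_unitaryGroup hd p), mul_one]

lemma map_conj_Smat_zpow (hd : d ≠ 0) (k : ℤ) :
    (Smat d ^ k).map (starRingEnd ℂ) = Smat d ^ k := by
  have hS : (Smat d).map (starRingEnd ℂ) = Smat d := by
    ext r s
    simp only [Smat, Matrix.map_apply, Matrix.of_apply]
    split_ifs <;> simp
  obtain ⟨m, hm⟩ : ∃ m : ℕ, Smat d ^ k = Smat d ^ m := by
    refine ⟨(k % d).toNat, ?_⟩
    rw [← zpow_natCast, Int.toNat_of_nonneg (Int.emod_nonneg _ (by exact_mod_cast hd))]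
    conv_lhs => rw [← Int.mul_ediv_add_emod k d]
    rw [Matrix.zpow_add (isUnit_det_Smat hd), Matrix.zpow_mul _ (isUnit_det_Smat hd),
      zpow_natCast, Smat_pow_self hd, Matrix.one_zpow, one_mul]
  rw [hm, Matrix.map_pow, hS]

lemma map_conj_Tmat_zpow (hd : d ≠ 0) (k : ℤ) :
    (Tmat d ^ k).map (starRingEnd ℂ) = Tmat d ^ (-k) := by
  obtain ⟨m, hm⟩ : ∃ m : ℕ, Tmat d ^ k = Tmat d ^ m := by
    refine ⟨(k % d).toNat, ?_⟩
    rw [← zpow_natCast, Int.toNat_of_nonneg (Int.emod_nonneg _ (by exact_mod_cast hd))]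
    conv_lhs => rw [← Int.mul_ediv_add_emod k d]
    rw [Matrix.zpow_add (isUnit_det_Tmat d), Matrix.zpow_mul _ (isUnit_det_Tmat d),
      zpow_natCast, Tmat_pow_self hd, Matrix.one_zpow, one_mul]
  rw [Matrix.zpow_neg (isUnit_det_Tmat d), hm]
  symm
  apply Matrix.inv_eq_right_inv
  have h := Matrix.mem_unitaryGroup_iff.mp (pow_mem (Tmat_mem_unitaryGroup d) m)
  have ht : (Tmat d ^ m)ᵀ = Tmat d ^ m := by
    rw [Tmat, Matrix.diagonal_pow, Matrix.diagonal_transpose]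
  rwa [Matrix.star_eq_conjTranspose, Matrix.conjTranspose, ht] at h

lemma Dmat_map_conj (hd : d ≠ 0) (p : ℤ × ℤ) :
    (Dmat d p).map (starRingEnd ℂ) = Dmat d (p.1, -p.2) := by
  have h : (Dmat d p).map (starRingEnd ℂ) = starRingEnd ℂ (tau d ^ (p.1 * p.2)) •
      ((Smat d ^ p.1).map (starRingEnd ℂ) * (Tmat d ^ p.2).map (starRingEnd ℂ)) := by
    rw [← Matrix.map_mul, Dmat]
    ext r s
    simp only [Matrix.map_apply, Matrix.smul_apply, smul_eq_mul, map_mul]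
  rw [h, map_conj_Smat_zpow hd, map_conj_Tmat_zpow hd, map_zpow₀, conj_tau, Dmat, _root_.inv_zpow,
    ← _root_.zpow_neg, mul_neg]

/-- Finite Stone–von Neumann theorem: a pair of unitaries of order `d` satisfying the Weyl
relation is unitarily equivalent to the pair of shift and clock matrices. -/
lemma exists_unitary_intertwining (hd : d ≠ 0) {X Z : Matrix (Fin d) (Fin d) ℂ}
    (hX : X ∈ Matrix.unitaryGroup (Fin d) ℂ) (hZ : Z ∈ Matrix.unitaryGroup (Fin d) ℂ)
    (hXd : X ^ d = 1) (hZd : Z ^ d = 1) (h : Z * X = omega d • (X * Z)) :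
    ∃ A ∈ Matrix.unitaryGroup (Fin d) ℂ, A * Smat d = X * A ∧ A * Tmat d = Z * A := by
  have : NeZero d := ⟨hd⟩
  obtain ⟨v, hv1, hv⟩ :=
    exists_unit_fixed_vector hd (Matrix.isUnit_det_of_mem_unitaryGroup hX) hZd h
  set A : Matrix (Fin d) (Fin d) ℂ := Matrix.of fun r s => ((X ^ (s : ℕ)) *ᵥ v) r with hA
  have hcol (M : Matrix (Fin d) (Fin d) ℂ) (r s : Fin d) :
      (M * A) r s = ((M * X ^ (s : ℕ)) *ᵥ v) r := by
    rw [← Matrix.mulVec_mulVec]; rfl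
  have hAS : A * Smat d = X * A := by
    ext r s
    rw [mul_Smat_apply hd, hcol, ← pow_succ', pow_eq_pow_mod _ hXd]
    rfl
  have hAT : A * Tmat d = Z * A := by
    ext r s
    have h1 := Matrix.mul_zpow_of_mul_eq_smul (omega_ne_zero d)
      (Matrix.isUnit_det_of_mem_unitaryGroup hX) h (s : ℕ)
    rw [zpow_natCast, zpow_natCast] at h1
    rw [hcol, h1, Matrix.smul_mulVec, ← Matrix.mulVec_mulVec, hv, Tmat, Matrix.mul_diagonal,
      mul_comm]
    rfl
  refine ⟨A, ?_, hAS, hAT⟩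
  rw [Matrix.mem_unitaryGroup_iff', Matrix.star_eq_conjTranspose]
  have hcomm : Tmat d * (Aᴴ * A) = Aᴴ * A * Tmat d := by
    have h1 : (Tmat d)ᴴ * Aᴴ = Aᴴ * Zᴴ := by
      rw [← Matrix.conjTranspose_mul, hAT, Matrix.conjTranspose_mul]
    have hT := Matrix.mem_unitaryGroup_iff.mp (Tmat_mem_unitaryGroup d)
    have hZ' := Matrix.mem_unitaryGroup_iff'.mp hZ
    rw [Matrix.star_eq_conjTranspose] at hT hZ'
    calc Tmat d * (Aᴴ * A) = Tmat d * (Aᴴ * (Zᴴ * Z) * A) := by rw [hZ', mul_one]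
      _ = Tmat d * (Aᴴ * Zᴴ) * (Z * A) := by simp only [mul_assoc]
      _ = (Tmat d * (Tmat d)ᴴ) * Aᴴ * (A * Tmat d) := by rw [← h1, hAT]; simp only [mul_assoc]
      _ = Aᴴ * A * Tmat d := by rw [hT, one_mul, mul_assoc]
  ext r s
  by_cases hrs : r = s
  · subst hrs
    have h1 : (Aᴴ * A) r r = star ((X ^ (r : ℕ)) *ᵥ v) ⬝ᵥ ((X ^ (r : ℕ)) *ᵥ v) := rfl
    rw [h1, Matrix.star_mulVec, ← Matrix.dotProduct_mulVec, Matrix.mulVec_mulVec,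
      ← Matrix.star_eq_conjTranspose, Matrix.mem_unitaryGroup_iff'.mp (pow_mem hX _),
      Matrix.one_mulVec, hv1, Matrix.one_apply_eq]
  · have h1 := congrFun (congrFun hcomm r) s
    rw [Tmat, Matrix.diagonal_mul, Matrix.mul_diagonal, mul_comm] at h1
    rw [Matrix.one_apply_ne hrs]
    by_contra hne
    exact hrs (Fin.ext ((isPrimitiveRoot_omega hd).pow_inj r.isLt s.isLt
      (mul_left_cancel₀ hne h1)))

/-- Every integer matrix of determinant `1` modulo `d̄` is realised by a unitary. -/
lemma exists_unitary_conj_Dmat (hd : d ≠ 0) {G : Matrix (Fin 2) (Fin 2) ℤ}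
    (hG : G.det ≡ 1 [ZMOD (dbar d)]) :
    ∃ A ∈ Matrix.unitaryGroup (Fin d) ℂ, ∀ p : ℤ × ℤ,
      A * Dmat d p * Aᴴ = Dmat d (Fapp G p) := by
  rw [Matrix.det_fin_two] at hG
  set x : ℤ × ℤ := (G 0 0, G 1 0)
  set z : ℤ × ℤ := (G 0 1, G 1 1)
  have hzx : symp z x ≡ 1 [ZMOD (dbar d)] := by
    simpa [symp, x, z, mul_comm] using hG
  have hXZ : Dmat d z * Dmat d x = omega d • (Dmat d x * Dmat d z) := by
    rw [Dmat_mul_comm hd, omega_zpow, tau_zpow_eq hd (hzx.mul_left 2), ← omega_zpow, zpow_one]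
  obtain ⟨A, hA, hAS, hAT⟩ := exists_unitary_intertwining hd (Dmat_mem_unitaryGroup hd x)
    (Dmat_mem_unitaryGroup hd z) (Dmat_pow_self hd x) (Dmat_pow_self hd z) hXZ
  refine ⟨A, hA, fun p => ?_⟩
  have h1 := Matrix.zpow_semiconj_conj hA (isUnit_det_Smat hd) (isUnit_det_Dmat hd x) hAS p.1
  have h2 := Matrix.zpow_semiconj_conj hA (isUnit_det_Tmat d) (isUnit_det_Dmat hd z) hAT p.2
  have hA' := Matrix.mem_unitaryGroup_iff'.mp hA
  rw [Matrix.star_eq_conjTranspose] at hA'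
  have h3 : A * Dmat d p * Aᴴ =
      tau d ^ (p.1 * p.2) • ((A * Smat d ^ p.1 * Aᴴ) * (A * Tmat d ^ p.2 * Aᴴ)) := by
    rw [Dmat, mul_smul_comm, smul_mul_assoc]
    congr 1
    calc A * (Smat d ^ p.1 * Tmat d ^ p.2) * Aᴴ
        = A * Smat d ^ p.1 * 1 * Tmat d ^ p.2 * Aᴴ := by simp only [mul_assoc, one_mul]
      _ = _ := by rw [← hA']; simp only [mul_assoc]
  have h4 : p.1 * p.2 + symp (p.1 • x) (p.2 • z) ≡ 0 [ZMOD (dbar d)] := by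
    have := (hzx.symm.sub_right (symp z x)).mul_left (p.1 * p.2)
    simp only [sub_self, mul_zero] at this
    convert this using 1
    simp [symp]
    ring
  rw [h3, h1, h2, Dmat_zpow hd, Dmat_zpow hd, Dmat_mul hd, smul_smul,
    ← zpow_add₀ (tau_ne_zero d), tau_zpow_eq hd h4, zpow_zero, one_smul]
  congr 1
  ext <;> simp [Fapp, x, z, mul_comm]

end WeylRelations

/-- For every integer matrix `F` with `det F ≡ −1 (mod d̄)` and every
`χ ∈ ℤ²` there is a unitary `A` with `A · conj(D_p) · A† = ω^{⟨χ,Fp⟩} D_{Fp}` for all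
`p ∈ ℤ²` (so the anti-unitary `ψ ↦ A·conj(ψ)` realizes `(F,χ)` in the extended
Clifford group). -/
theorem stmt11 (d : ℕ) (hd : 2 ≤ d) (F : Matrix (Fin 2) (Fin 2) ℤ)
    (hdet : F.det ≡ -1 [ZMOD (dbar d)]) (χ : ℤ × ℤ) :
    ∃ A : Matrix (Fin d) (Fin d) ℂ,
      A ∈ Matrix.unitaryGroup (Fin d) ℂ ∧
      ∀ p : ℤ × ℤ,
        A * (Dmat d p).map (starRingEnd ℂ) * Aᴴ =
          omega d ^ symp χ (Fapp F p) • Dmat d (Fapp F p) := by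
  have hd0 : d ≠ 0 := by omega
  set G : Matrix (Fin 2) (Fin 2) ℤ := !![F 0 0, -F 0 1; F 1 0, -F 1 1] with hGdef
  have hG : G.det ≡ 1 [ZMOD (dbar d)] := by
    have h := hdet.neg
    rw [Matrix.det_fin_two] at h
    simp only [hGdef, Matrix.det_fin_two_of]
    convert h using 1 <;> ring
  obtain ⟨A, hA, hAD⟩ := exists_unitary_conj_Dmat hd0 hG
  refine ⟨Dmat d χ * A, mul_mem (Dmat_mem_unitaryGroup hd0 χ) hA, fun p => ?_⟩
  have hFG : Fapp G (p.1, -p.2) = Fapp F p := by simp [Fapp, hGdef]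
  rw [Dmat_map_conj hd0, Matrix.conjTranspose_mul, ← Dmat_conj hd0, ← hFG, ← hAD]
  simp only [mul_assoc]
end
end

section
/- Let d ≥ 2 be an integer and let d̄ = d if d is odd, d̄ = 2d if d is even. The following are equivalent: (i) there exist integers α, δ with αδ ≡ 1 (mod d̄), α + δ ≡ −1 (mod d), and not both α ≡ 1 and δ ≡ 1 (mod d̄) — i.e. there exists a diagonal matrix F ∈ SL(2, ℤ/d̄ℤ), different from the identity matrix, with trace F ≡ −1 (mod d), which is exactly the condition that some canonical order-3 Clifford unitary [F,χ] ∈ C(d)/Cc(d) has diagonal F; (ii) d has at least one prime divisor ≡ 1 (mod 3), d has no prime divisor ≡ 2 (mod 3), and d is not divisible by 9. -/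
theorem dvd_dbar (d : ℕ) : d ∣ dbar d := by
  unfold dbar
  split_ifs
  · exact dvd_rfl
  · exact dvd_mul_left d 2

/-- A prime other than `3` dividing `x² + x + 1` is `≡ 1 (mod 3)`, as `x` has order `3`. -/
theorem Nat.Prime.mod_three_of_dvd_sq_add_self_add_one {p : ℕ} (hp : p.Prime) (hp3 : p ≠ 3)
    {x : ℤ} (h : (p : ℤ) ∣ x ^ 2 + x + 1) : p % 3 = 1 := by
  have := Fact.mk hp
  have := Fact.mk Nat.prime_three
  have h0 : (x : ZMod p) ^ 2 + x + 1 = 0 := by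
    exact_mod_cast (ZMod.intCast_zmod_eq_zero_iff_dvd _ p).2 h
  have h3 : (x : ZMod p) ^ 3 = 1 := by linear_combination ((x : ZMod p) - 1) * h0
  have h1 : (x : ZMod p) ≠ 1 := by
    intro h1
    rw [h1] at h0
    have h0' : ((3 : ℕ) : ZMod p) = 0 := by
      push_cast
      linear_combination h0
    exact hp3 ((Nat.prime_dvd_prime_iff_eq hp Nat.prime_three).1
      ((ZMod.natCast_eq_zero_iff 3 p).1 h0'))
  have hx : (x : ZMod p) ≠ 0 := by
    intro hx
    simp [hx] at h0
  have hdvd := ZMod.orderOf_dvd_card_sub_one hx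
  rw [orderOf_eq_prime h3 h1] at hdvd
  have := hp.two_le
  omega

theorem not_nine_dvd_sq_add_self_add_one (x : ℤ) : ¬ (9 : ℤ) ∣ x ^ 2 + x + 1 := by
  intro h
  have h0 : (x : ZMod 9) ^ 2 + x + 1 = 0 := by
    exact_mod_cast (ZMod.intCast_zmod_eq_zero_iff_dvd _ 9).2 h
  have key : ∀ y : ZMod 9, y ^ 2 + y + 1 ≠ 0 := by decide
  exact key _ h0

theorem Nat.Prime.exists_dvd_sq_add_self_add_one {p : ℕ} (hp : p.Prime) (h : p % 3 = 1) :
    ∃ x : ℤ, (p : ℤ) ∣ x ^ 2 + x + 1 := by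
  have := Fact.mk hp
  have := Fact.mk Nat.prime_three
  obtain ⟨g, hg⟩ := exists_prime_orderOf_dvd_card (G := (ZMod p)ˣ) 3 (by
    rw [ZMod.card_units]
    omega)
  have h3 : (g : ZMod p) ^ 3 = 1 := by
    rw [← Units.val_pow_eq_pow_val, ← hg, pow_orderOf_eq_one, Units.val_one]
  have h1 : (g : ZMod p) - 1 ≠ 0 := by
    intro h1
    have : g = 1 := Units.ext (sub_eq_zero.1 h1)
    simp [this] at hg
  obtain ⟨x, hx⟩ := ZMod.intCast_surjective (g : ZMod p)
  refine ⟨x, (ZMod.intCast_zmod_eq_zero_iff_dvd _ p).1 ?_⟩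
  push_cast
  rw [hx]
  apply mul_left_cancel₀ h1
  linear_combination h3

/-- Hensel lifting of roots of `x² + x + 1` to prime powers. -/
theorem Nat.Prime.exists_pow_dvd_sq_add_self_add_one {p : ℕ} (hp : p.Prime) (h : p % 3 = 1)
    (k : ℕ) : ∃ x : ℤ, (p : ℤ) ^ (k + 1) ∣ x ^ 2 + x + 1 := by
  induction k with
  | zero => simpa using hp.exists_dvd_sq_add_self_add_one h
  | succ k ih =>
    obtain ⟨x, c, hc⟩ := ih
    have hcop : IsCoprime (p : ℤ) (2 * x + 1) := by
      rw [(Nat.prime_iff_prime_int.1 hp).coprime_iff_not_dvd]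
      rintro ⟨e, he⟩
      have h3 : (p : ℤ) ∣ ((3 : ℕ) : ℤ) :=
        ⟨4 * (p ^ k * c) - p * e ^ 2, by
          push_cast
          linear_combination 4 * hc - (2 * x + 1 + p * e) * he⟩
      have := (Nat.prime_dvd_prime_iff_eq hp Nat.prime_three).1 (Int.natCast_dvd_natCast.1 h3)
      omega
    obtain ⟨a, u, hau⟩ := hcop
    refine ⟨x - (x ^ 2 + x + 1) * u, c * a + p ^ k * c ^ 2 * u ^ 2, ?_⟩
    linear_combination (p * a + (x ^ 2 + x + 1 + p ^ (k + 1) * c) * u ^ 2) * hc -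
      (x ^ 2 + x + 1) * hau

theorem exists_dvd_sq_add_self_add_one {d : ℕ} (h0 : d ≠ 0)
    (h2 : ∀ p : ℕ, p.Prime → p ∣ d → p % 3 ≠ 2) (h9 : ¬ 9 ∣ d) :
    ∃ x : ℤ, (d : ℤ) ∣ x ^ 2 + x + 1 := by
  induction d using Nat.recOnPosPrimePosCoprime with
  | zero => exact absurd rfl h0
  | one => exact ⟨0, by simp⟩
  | prime_pow p n hp hn =>
    obtain ⟨k, rfl⟩ := Nat.exists_eq_succ_of_ne_zero hn.ne'
    by_cases hp3 : p = 3
    · subst hp3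
      have hk : k = 0 := by
        by_contra hk
        exact h9 (pow_dvd_pow 3 (show 2 ≤ k + 1 by omega))
      subst hk
      exact ⟨1, by norm_num⟩
    · have hmod : p % 3 = 1 := by
        have hne := h2 p hp (dvd_pow_self p (Nat.succ_ne_zero k))
        have h03 : ¬ 3 ∣ p := fun hdvd ↦
          hp3 ((Nat.prime_dvd_prime_iff_eq Nat.prime_three hp).1 hdvd).symm
        omega
      exact_mod_cast hp.exists_pow_dvd_sq_add_self_add_one hmod k
  | coprime a b ha hb hab iha ihb =>
    obtain ⟨x, hx⟩ := iha (by omega) (fun p hp hpa ↦ h2 p hp (hpa.mul_right b))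
      fun h ↦ h9 (h.mul_right b)
    obtain ⟨y, hy⟩ := ihb (by omega) (fun p hp hpb ↦ h2 p hp (hpb.mul_left a))
      fun h ↦ h9 (h.mul_left a)
    have hab' : IsCoprime (a : ℤ) b := Nat.isCoprime_iff_coprime.2 hab
    obtain ⟨u, v, huv⟩ := id hab'
    refine ⟨x + u * a * (y - x), ?_⟩
    push_cast
    refine hab'.mul_dvd ?_ ?_
    · obtain ⟨c, hc⟩ := hx
      exact ⟨c + u * (y - x) * (2 * x + 1 + u * a * (y - x)), by linear_combination hc⟩
    · obtain ⟨c, hc⟩ := hy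
      refine ⟨c + v * (x - y) * (2 * y + 1 + v * b * (x - y)), ?_⟩
      have key : x + u * a * (y - x) = y + v * b * (x - y) := by
        linear_combination (y - x) * huv
      rw [key]
      linear_combination hc

/-- For `d ≥ 2` the following are equivalent.
(i) There is a diagonal matrix `F = diag(α,δ) ∈ SL(2, ℤ/d̄ℤ)`, not the identity,
with `trace F ≡ −1 (mod d)` — i.e. integers `α, δ` with `αδ ≡ 1 (mod d̄)`,
`α + δ ≡ −1 (mod d)`, and not both `α ≡ 1` and `δ ≡ 1 (mod d̄)` (the condition that
some canonical order-3 Clifford unitary `[F,χ]` has diagonal `F`).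
(ii) `d` has a prime divisor `≡ 1 (mod 3)`, no prime divisor `≡ 2 (mod 3)`, and
`9 ∤ d`. -/
theorem stmt15 (d : ℕ) (hd : 2 ≤ d) :
    (∃ α δ : ℤ, α * δ ≡ 1 [ZMOD (dbar d)] ∧ α + δ ≡ -1 [ZMOD (d : ℕ)] ∧
        ¬ (α ≡ 1 [ZMOD (dbar d)] ∧ δ ≡ 1 [ZMOD (dbar d)])) ↔
      ((∃ p : ℕ, p.Prime ∧ p ∣ d ∧ p % 3 = 1) ∧
        (∀ p : ℕ, p.Prime → p ∣ d → p % 3 ≠ 2) ∧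
        ¬ (9 ∣ d)) := by
  constructor
  · rintro ⟨α, δ, hmul, hadd, hne⟩
    have hmul' : α * δ ≡ 1 [ZMOD d] := hmul.of_dvd (Int.natCast_dvd_natCast.2 (dvd_dbar d))
    have hα : (d : ℤ) ∣ α ^ 2 + α + 1 := by
      obtain ⟨a, ha⟩ := hmul'.dvd
      obtain ⟨b, hb⟩ := hadd.dvd
      exact ⟨a - α * b, by linear_combination ha - α * hb⟩
    have hprime : ∀ p : ℕ, p.Prime → p ∣ d → p ≠ 3 → p % 3 = 1 := fun p hp hpd hp3 ↦
      hp.mod_three_of_dvd_sq_add_self_add_one hp3 ((Int.natCast_dvd_natCast.2 hpd).trans hα)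
    have h9 : ¬ 9 ∣ d := fun h ↦
      not_nine_dvd_sq_add_self_add_one α ((Int.natCast_dvd_natCast.2 h).trans hα)
    refine ⟨?_, fun p hp hpd ↦ ?_, h9⟩
    · by_contra! hno
      have hpow := Nat.eq_prime_pow_of_unique_prime_dvd (n := d) (p := 3) (by omega)
        fun {q} hq hqd ↦ by
          by_contra hq3
          exact hno q hq hqd (hprime q hq hqd hq3)
      have hlen : d.primeFactorsList.length = 1 := by
        have hlt : d.primeFactorsList.length < 2 := by
          by_contra! hle
          exact h9 (hpow ▸ pow_dvd_pow 3 hle)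
        have hne0 : d.primeFactorsList.length ≠ 0 := by
          intro h0
          rw [h0] at hpow
          omega
        omega
      rw [hlen, pow_one] at hpow
      subst hpow
      have hα1 : α ≡ 1 [ZMOD 3] := by
        have h0 : (α : ZMod 3) ^ 2 + α + 1 = 0 := by
          exact_mod_cast (ZMod.intCast_zmod_eq_zero_iff_dvd _ 3).2 hα
        have key : ∀ y : ZMod 3, y ^ 2 + y + 1 = 0 → y = 1 := by decide
        exact (ZMod.intCast_eq_intCast_iff α 1 3).1 (by simpa using key _ h0)
      have hadd' : α + δ ≡ -1 [ZMOD 3] := hadd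
      apply hne
      change α ≡ 1 [ZMOD 3] ∧ δ ≡ 1 [ZMOD 3]
      simp only [Int.ModEq] at *
      omega
    · by_cases hp3 : p = 3
      · simp [hp3]
      · simp [hprime p hp hpd hp3]
  · rintro ⟨⟨p, hp, hpd, hp1⟩, h2, h9⟩
    have hodd : d % 2 = 1 := by
      by_contra h
      exact h2 2 Nat.prime_two (by omega) rfl
    have hdbar : dbar d = d := if_pos hodd
    obtain ⟨x, hx⟩ := exists_dvd_sq_add_self_add_one (by omega) h2 h9
    rw [hdbar]
    refine ⟨x, -1 - x, ?_, by simp, ?_⟩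
    · apply Int.modEq_of_dvd
      convert hx using 1
      ring
    · rintro ⟨h1, -⟩
      obtain ⟨c, hc⟩ := h1.dvd
      obtain ⟨e, he⟩ := hx
      have h3 : (d : ℤ) ∣ ((3 : ℕ) : ℤ) := ⟨e + c * (x + 2), by
        push_cast
        linear_combination he + (x + 2) * hc⟩
      have := (Nat.prime_dvd_prime_iff_eq hp Nat.prime_three).1
        (hpd.trans (Int.natCast_dvd_natCast.1 h3))
      omega
end
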